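/- arXiv:1911.06417 — 2 statements merged into one kernel-verified Lean document; each statement's English description precedes it below -/
import Mathlib

section
/- Let I ⊆ S be a squarefree monomial ideal with minimal primary decomposition I = I_{α_1} ∩ ⋯ ∩ I_{α_r} satisfying I_{α_1} + ⋯ + I_{α_r} = (x_1,…,x_n), and set μ = μ_S(J_p). Then the complexity sequence c_e := μ_S((I^{[p^e]} :_S I)/(L_e + I^{[p^e]})) satisfies c_0 = 0, c_1 = μ + 1, and c_e = μ for all e ≥ 2. -/
noncomputable section

/-- The `q`-th Frobenius power of an ideal: the ideal generated by `{f^q : f ∈ I}`. -/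
def frobPow {R : Type*} [CommRing R] (q : ℕ) (I : Ideal R) : Ideal R :=
  Ideal.span ((fun f => f ^ q) '' (I : Set R))

/-- The monomial `x^γ = x_1^{γ_1} ⋯ x_n^{γ_n}` in `k[[x_1,…,x_n]]`. -/
def mon (k : Type*) [Field k] {n : ℕ} (γ : Fin n → ℕ) : MvPowerSeries (Fin n) k :=
  ∏ i, (MvPowerSeries.X i : MvPowerSeries (Fin n) k) ^ γ i

/-- The face ideal `I_α`, generated by the variables `x_i` with `α i = 1`. -/
def faceIdeal (k : Type*) [Field k] {n : ℕ} (α : Fin n → ℕ) :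
    Ideal (MvPowerSeries (Fin n) k) :=
  Ideal.span {f | ∃ i, α i = 1 ∧ f = MvPowerSeries.X i}

/-- `I = I_{α_1} ∩ ⋯ ∩ I_{α_r}` is the minimal primary decomposition of the squarefree
monomial ideal `I` into face ideals: each `α j` is a nonzero `{0,1}`-vector, `I` is the
intersection of the face ideals `I_{α j}`, and the decomposition is irredundant (the
supports of the `α j` are pairwise incomparable). -/
def IsMinFaceDecomp (k : Type*) [Field k] {n r : ℕ} (α : Fin r → Fin n → ℕ)
    (I : Ideal (MvPowerSeries (Fin n) k)) : Prop :=
  (∀ j i, α j i = 0 ∨ α j i = 1) ∧ (∀ j, α j ≠ 0) ∧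
    I = ⨅ j, faceIdeal k (α j) ∧
    ∀ j l, j ≠ l → ¬ ({i | α j i = 1} ⊆ {i | α l i = 1})

/-- `x^γ` is a minimal monomial generator of the monomial ideal `J`: `x^γ ∈ J` and no
monomial properly dividing `x^γ` belongs to `J`. -/
def IsMinGen (k : Type*) [Field k] {n : ℕ} (J : Ideal (MvPowerSeries (Fin n) k))
    (γ : Fin n → ℕ) : Prop :=
  mon k γ ∈ J ∧ ∀ δ : Fin n → ℕ, (∀ i, δ i ≤ γ i) → δ ≠ γ → mon k δ ∉ J

/-- `J_q`: the unique minimal monomial ideal with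
`(I^{[q]} :_S I) = I^{[q]} + J_q + ((x_1⋯x_n)^{q-1})`; equivalently, the ideal generated by
those minimal monomial generators of `(I^{[q]} :_S I)` lying neither in `I^{[q]}` nor in
the principal ideal `((x_1⋯x_n)^{q-1})`. -/
def Jideal (k : Type*) [Field k] {n : ℕ} (q : ℕ) (I : Ideal (MvPowerSeries (Fin n) k)) :
    Ideal (MvPowerSeries (Fin n) k) :=
  Ideal.span (mon k '' {γ | IsMinGen k ((frobPow q I).colon I) γ ∧
    mon k γ ∉ frobPow q I ∧ mon k γ ∉ Ideal.span {mon k (fun _ => 1) ^ (q - 1)}})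

/-- `L_e = Σ K_{β_1}·K_{β_2}^{[p^{β_1}]} ⋯ K_{β_s}^{[p^{β_1+⋯+β_{s-1}}]}`, the sum over all
`s ≥ 2` and all `1 ≤ β_1,…,β_s < e` with `β_1 + ⋯ + β_s = e`, where `K_a = (I^{[p^a]} :_S I)`. -/
def Lideal {R : Type*} [CommRing R] (p e : ℕ) (I : Ideal R) : Ideal R :=
  ⨆ (s : ℕ) (_ : 2 ≤ s) (β : Fin s → ℕ)
    (_ : (∀ i, 1 ≤ β i ∧ β i < e) ∧ ∑ i, β i = e),
    ∏ i, frobPow (p ^ (∑ j ∈ Finset.Iio i, β j)) ((frobPow (p ^ β i) I).colon I)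

/-- The minimal number of generators of the quotient module `A/B` (for ideals `B ≤ A`):
the least cardinality of a finite set `s` with `A = B + (s)`. -/
noncomputable def muQuot {R : Type*} [CommRing R] (A B : Ideal R) : ℕ :=
  sInf {c | ∃ s : Finset R, s.card = c ∧ A = B ⊔ Ideal.span (s : Set R)}

/-- The minimal number of generators of an ideal. -/
noncomputable def muIdeal {R : Type*} [CommRing R] (J : Ideal R) : ℕ :=
  sInf {c | ∃ s : Finset R, s.card = c ∧ Ideal.span (s : Set R) = J}

/-- The complexity sequence of the Frobenius algebra of operators on the injective hull of
the residue field of `R = S/I`: `c_0 = 0` (by convention) and, for `e ≥ 1`,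
`c_e = μ_S((I^{[p^e]} :_S I) / (L_e + I^{[p^e]}))` (Katzman's description). -/
noncomputable def cseq (p : ℕ) (k : Type*) [Field k] {n : ℕ}
    (I : Ideal (MvPowerSeries (Fin n) k)) : ℕ → ℕ
  | 0 => 0
  | e + 1 =>
    muQuot ((frobPow (p ^ (e + 1)) I).colon I)
      (Lideal p (e + 1) I ⊔ frobPow (p ^ (e + 1)) I)

section Monomials

open MvPowerSeries

variable {k : Type*} [Field k] {n : ℕ}

theorem mon_eq_monomial (γ : Fin n → ℕ) :
    mon k γ = monomial (Finsupp.equivFunOnFinite.symm γ) (1 : k) := by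
  rw [monomial_one_eq, Finsupp.prod_fintype _ _ (by simp)]
  rfl

theorem mon_add (γ δ : Fin n → ℕ) : mon k (γ + δ) = mon k γ * mon k δ := by
  simp [mon, pow_add, Finset.prod_mul_distrib]

theorem mon_nsmul (q : ℕ) (γ : Fin n → ℕ) : mon k (q • γ) = mon k γ ^ q := by
  simp [mon, ← pow_mul, mul_comm, ← Finset.prod_pow]

open Classical in
theorem coeff_mon_mul (γ : Fin n → ℕ) (d : Fin n →₀ ℕ) (f : MvPowerSeries (Fin n) k) :
    coeff d (mon k γ * f) =
      if γ ≤ ⇑d then coeff (d - Finsupp.equivFunOnFinite.symm γ) f else 0 := by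
  rw [mon_eq_monomial, coeff_monomial_mul, one_mul]
  exact if_congr Iff.rfl rfl rfl

theorem coeff_mon (γ : Fin n → ℕ) (d : Fin n →₀ ℕ) :
    coeff d (mon k γ) = if ⇑d = γ then (1 : k) else 0 := by
  classical
  rw [mon_eq_monomial, coeff_monomial]
  congr 1
  rw [Equiv.eq_symm_apply]
  rfl

theorem mon_injective : Function.Injective (mon k : (Fin n → ℕ) → MvPowerSeries (Fin n) k) := by
  intro γ δ h
  have h := congrArg (coeff (Finsupp.equivFunOnFinite.symm γ)) h
  by_contra hne
  simp [coeff_mon, hne] at h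

theorem mem_span_mon_of_finset (G : Finset (Fin n → ℕ)) (f : MvPowerSeries (Fin n) k)
    (hf : ∀ d, coeff d f ≠ 0 → ∃ u ∈ G, u ≤ ⇑d) :
    f ∈ Ideal.span (mon k '' (G : Set (Fin n → ℕ))) := by
  classical
  induction G using Finset.induction_on generalizing f with
  | empty =>
    have : f = 0 := by
      ext d
      by_contra h
      simpa using hf d h
    simp [this]
  | insert a G _ ih =>
    let g : MvPowerSeries (Fin n) k := fun d => coeff (d + Finsupp.equivFunOnFinite.symm a) f
    have hg : ∀ d, coeff d g = coeff (d + Finsupp.equivFunOnFinite.symm a) f := fun _ => rfl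
    have hfg : ∀ d : Fin n →₀ ℕ, coeff d (f - mon k a * g) = if a ≤ ⇑d then 0 else coeff d f := by
      intro d
      rw [map_sub, coeff_mon_mul]
      split_ifs with h
      · rw [hg, tsub_add_cancel_of_le (show Finsupp.equivFunOnFinite.symm a ≤ d from h), sub_self]
      · exact sub_zero _
    rw [← sub_add_cancel f (mon k a * g)]
    refine Ideal.add_mem _ ?_ (Ideal.mul_mem_right _ _ (Ideal.subset_span ⟨a, by simp, rfl⟩))
    refine Ideal.span_mono (Set.image_mono (by simp)) (ih _ fun d hd => ?_)
    rw [hfg] at hd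
    split_ifs at hd with h
    · exact absurd rfl hd
    · obtain ⟨u, hu, hud⟩ := hf d hd
      rcases Finset.mem_insert.1 hu with rfl | hu
      · exact absurd hud h
      · exact ⟨u, hu, hud⟩

theorem finite_setOf_minimal (U : Set (Fin n → ℕ)) : {γ | Minimal (· ∈ U) γ}.Finite :=
  WellQuasiOrderedLE.finite_of_isAntichain (setOfPred_minimal_antichain _)

theorem mem_span_mon_iff (U : Set (Fin n → ℕ)) (f : MvPowerSeries (Fin n) k) :
    f ∈ Ideal.span (mon k '' U) ↔ ∀ d, coeff d f ≠ 0 → ∃ u ∈ U, u ≤ ⇑d := by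
  classical
  constructor
  · intro hf
    induction hf using Submodule.span_induction with
    | mem x hx =>
      obtain ⟨u, hu, rfl⟩ := hx
      intro d hd
      rw [coeff_mon] at hd
      exact ⟨u, hu, by simp_all⟩
    | zero => simp
    | add x y _ _ hx hy =>
      intro d hd
      by_cases h : coeff d x = 0
      · exact hy d (by simpa [h] using hd)
      · exact hx d h
    | smul a x _ hx =>
      intro d hd
      rw [smul_eq_mul, coeff_mul] at hd
      obtain ⟨⟨b, c⟩, hbc, h⟩ := Finset.exists_ne_zero_of_sum_ne_zero hd
      obtain ⟨u, hu, huc⟩ := hx c (right_ne_zero_of_mul h)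
      refine ⟨u, hu, huc.trans ?_⟩
      rw [← Finset.HasAntidiagonal.mem_antidiagonal.1 hbc]
      exact fun i => by simp
  · intro hf
    refine Ideal.span_mono (Set.image_mono ?_)
      (mem_span_mon_of_finset (finite_setOf_minimal U).toFinset f fun d hd => ?_)
    · intro γ hγ
      exact (by simpa using hγ : Minimal (· ∈ U) γ).prop
    · obtain ⟨u, hu, hud⟩ := hf d hd
      obtain ⟨v, hvu, hv⟩ := exists_minimal_le_of_wellFoundedLT (· ∈ U) u hu
      exact ⟨v, by simpa using hv, hvu.trans hud⟩

theorem mon_mem_span_mon_iff (U : Set (Fin n → ℕ)) (γ : Fin n → ℕ) :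
    mon k γ ∈ Ideal.span (mon k '' U) ↔ ∃ u ∈ U, u ≤ γ := by
  rw [mem_span_mon_iff]
  constructor
  · intro h
    exact h (Finsupp.equivFunOnFinite.symm γ) (by simp [coeff_mon])
  · intro h d hd
    rw [coeff_mon] at hd
    have : ⇑d = γ := by simp_all
    rwa [this]

theorem mon_mem_span_mon_iff_of_isUpperSet {U : Set (Fin n → ℕ)} (hU : IsUpperSet U)
    (γ : Fin n → ℕ) : mon k γ ∈ Ideal.span (mon k '' U) ↔ γ ∈ U := by
  rw [mon_mem_span_mon_iff]
  exact ⟨fun ⟨_, hu, h⟩ => hU h hu, fun h => ⟨γ, h, le_rfl⟩⟩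

theorem span_mon_le_span_mon {U V : Set (Fin n → ℕ)} (h : ∀ u ∈ U, ∃ v ∈ V, v ≤ u) :
    Ideal.span (mon k '' U) ≤ Ideal.span (mon k '' V) := by
  rw [Ideal.span_le]
  rintro _ ⟨u, hu, rfl⟩
  exact (mon_mem_span_mon_iff V u).2 (h u hu)

theorem span_mon_mul_span_mon_le {U V W : Set (Fin n → ℕ)}
    (h : ∀ u ∈ U, ∀ v ∈ V, ∃ w ∈ W, w ≤ u + v) :
    Ideal.span (mon k '' U) * Ideal.span (mon k '' V) ≤ Ideal.span (mon k '' W) := by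
  rw [Ideal.span_mul_span', Ideal.span_le]
  rintro _ ⟨_, ⟨u, hu, rfl⟩, _, ⟨v, hv, rfl⟩, rfl⟩
  simp only [← mon_add]
  exact (mon_mem_span_mon_iff W _).2 (h u hu v hv)

theorem isMinGen_span_mon_iff {U : Set (Fin n → ℕ)} (hU : IsUpperSet U) (γ : Fin n → ℕ) :
    IsMinGen k (Ideal.span (mon k '' U)) γ ↔ Minimal (· ∈ U) γ := by
  simp only [IsMinGen, mon_mem_span_mon_iff_of_isUpperSet hU]
  refine and_congr_right fun _ => ⟨fun h δ hδ hle => ?_, fun h δ hle hne hδ => ?_⟩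
  · by_contra hn
    exact h δ hle (fun e => hn e.ge) hδ
  · exact hne (le_antisymm hle (h hδ hle))

theorem coeff_mul_of_minimal {U : Set (Fin n → ℕ)} {f : MvPowerSeries (Fin n) k}
    (hf : f ∈ Ideal.span (mon k '' U)) {g : Fin n →₀ ℕ} (hg : Minimal (· ∈ U) ⇑g)
    (a : MvPowerSeries (Fin n) k) : coeff g (a * f) = coeff 0 a * coeff g f := by
  classical
  rw [coeff_mul, Finset.sum_eq_single (0, g)]
  · rintro ⟨b, c⟩ hbc hne
    by_contra h
    obtain ⟨u, hu, huc⟩ := (mem_span_mon_iff U f).1 hf c (right_ne_zero_of_mul h)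
    have hbc : b + c = g := by simpa using hbc
    have hcg : ⇑c ≤ ⇑g := by
      rw [← hbc]
      exact fun i => by simp
    have hc : c = g := DFunLike.coe_injective (le_antisymm hcg ((hg.2 hu (huc.trans hcg)).trans huc))
    subst hc
    exact hne (by simpa using hbc)
  · simp

/-- If `A = B + (x^g : g ∈ G)` where each `g ∈ G` is minimal among the exponents of `A` and `x^g`
is not in the monomial hull of `B`, then `A / B` needs exactly `|G|` generators. -/
theorem muQuot_eq_ncard {U V G : Set (Fin n → ℕ)} {A B : Ideal (MvPowerSeries (Fin n) k)}
    (hA : A = B ⊔ Ideal.span (mon k '' G)) (hAU : A ≤ Ideal.span (mon k '' U))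
    (hBV : B ≤ Ideal.span (mon k '' V)) (hGU : ∀ g ∈ G, Minimal (· ∈ U) g)
    (hGV : ∀ g ∈ G, ∀ v ∈ V, ¬ v ≤ g) : muQuot A B = G.ncard := by
  classical
  have hfin : G.Finite := (finite_setOf_minimal U).subset hGU
  refine le_antisymm (Nat.sInf_le ⟨(hfin.toFinset).image (mon k), ?_, by simpa using hA⟩)
    (le_csInf ⟨_, (hfin.toFinset).image (mon k), rfl, by simpa using hA⟩ ?_)
  · rw [Finset.card_image_of_injective _ mon_injective, Set.ncard_eq_toFinset_card G hfin]
  · rintro _ ⟨s, rfl, hs⟩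
    have := hfin.fintype
    let φ : MvPowerSeries (Fin n) k →ₗ[k] (G → k) :=
      LinearMap.pi fun g => coeff (Finsupp.equivFunOnFinite.symm (g : Fin n → ℕ))
    have hφ : ∀ f ∈ A, ∀ a, φ (a * f) = coeff 0 a • φ f := fun f hf a =>
      funext fun g => coeff_mul_of_minimal (hAU hf) (hGU g g.2) a
    have hφB : ∀ f ∈ B, φ f = 0 := by
      intro f hf
      ext g
      by_contra h
      obtain ⟨v, hv, hvg⟩ := (mem_span_mon_iff V f).1 (hBV hf) _ h
      exact hGV g g.2 v hv hvg
    have hspan : ∀ t ∈ Ideal.span (s : Set (MvPowerSeries (Fin n) k)),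
        φ t ∈ Submodule.span k (φ '' s) := by
      intro t ht
      induction ht using Submodule.span_induction with
      | mem x hx => exact Submodule.subset_span ⟨x, hx, rfl⟩
      | zero => simp
      | add x y _ _ hx hy => simpa using add_mem hx hy
      | smul a x hx' hx =>
        rw [smul_eq_mul, hφ x (hs ▸ Ideal.mem_sup_right hx')]
        exact Submodule.smul_mem _ _ hx
    have htop : Submodule.span k (φ '' s) = ⊤ := by
      rw [eq_top_iff, ← (Pi.basisFun k G).span_eq, Submodule.span_le]
      rintro _ ⟨g, rfl⟩
      have hg : mon k (g : Fin n → ℕ) ∈ A :=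
        hA ▸ Ideal.mem_sup_right (Ideal.subset_span ⟨g, g.2, rfl⟩)
      have hφg : φ (mon k (g : Fin n → ℕ)) = Pi.basisFun k G g := by
        funext g'
        rw [Pi.basisFun_apply, Pi.single_apply]
        exact (coeff_mon _ _).trans (if_congr Subtype.ext_iff.symm rfl rfl)
      rw [hs] at hg
      obtain ⟨b, hb, t, ht, hbt⟩ := Submodule.mem_sup.1 hg
      rw [← hφg, ← hbt, map_add, hφB b hb, zero_add]
      exact hspan t ht
    have hcard := finrank_span_finset_le_card (R := k) (s.image φ)
    rw [Set.finrank, Finset.coe_image, htop, finrank_top, Module.finrank_fintype_fun_eq_card] at hcard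
    rw [← Nat.card_coe_set_eq, Nat.card_eq_fintype_card]
    exact hcard.trans Finset.card_image_le

theorem muIdeal_eq_muQuot_bot {R : Type*} [CommRing R] (J : Ideal R) : muIdeal J = muQuot J ⊥ := by
  simp only [muIdeal, muQuot, bot_sup_eq, eq_comm (a := J)]

end Monomials

section Exponents

variable {n r : ℕ} {A : Fin r → Set (Fin n)}

/-- The exponents of the monomials in `I^{[q]}`, where `I` is the intersection of the face ideals
of the sets `A j`. -/
def frobExp (A : Fin r → Set (Fin n)) (q : ℕ) : Set (Fin n → ℕ) :=
  {γ | ∀ j, ∃ i ∈ A j, q ≤ γ i}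

/-- The exponents of the monomials in `(I^{[q]} : I)`, where `I` is the intersection of the face
ideals of the sets `A j`. -/
def colonExp (A : Fin r → Set (Fin n)) (q : ℕ) : Set (Fin n → ℕ) :=
  {γ | ∀ j, (∃ i ∈ A j, q ≤ γ i) ∨ ∀ i ∈ A j, q ≤ γ i + 1}

/-- The exponents of the minimal generators of `(I^{[q]} : I)` that lie neither in `I^{[q]}` nor
in `((x_1⋯x_n)^{q-1})`. -/
def genExp (A : Fin r → Set (Fin n)) (q : ℕ) : Set (Fin n → ℕ) :=
  {γ | Minimal (· ∈ colonExp A q) γ ∧ γ ∉ frobExp A q ∧ ∃ i, γ i + 1 < q}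

theorem isUpperSet_frobExp (q : ℕ) : IsUpperSet (frobExp A q) := by
  intro γ δ h hγ j
  obtain ⟨i, hi, hq⟩ := hγ j
  exact ⟨i, hi, hq.trans (h i)⟩

theorem isUpperSet_colonExp (q : ℕ) : IsUpperSet (colonExp A q) := by
  intro γ δ h hγ j
  rcases hγ j with ⟨i, hi, hq⟩ | hq
  · exact Or.inl ⟨i, hi, hq.trans (h i)⟩
  · exact Or.inr fun i hi => (hq i hi).trans (Nat.add_le_add_right (h i) 1)

theorem frobExp_subset_colonExp (q : ℕ) : frobExp A q ⊆ colonExp A q :=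
  fun _ h j => Or.inl (h j)

theorem add_mem_frobExp {q : ℕ} {γ u : Fin n → ℕ} (hγ : γ ∈ colonExp A q) (hu : u ∈ frobExp A 1) :
    γ + u ∈ frobExp A q := by
  intro j
  rcases hγ j with ⟨i, hi, hq⟩ | hq
  · exact ⟨i, hi, hq.trans (by simp)⟩
  · obtain ⟨i, hi, h1⟩ := hu j
    exact ⟨i, hi, (hq i hi).trans (by simpa using h1)⟩

theorem mem_colonExp_of_forall_add_mem (hA : ∀ j l, j ≠ l → ¬ A j ⊆ A l) {q : ℕ} {γ : Fin n → ℕ}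
    (h : ∀ u ∈ frobExp A 1, γ + u ∈ frobExp A q) : γ ∈ colonExp A q := by
  classical
  intro j
  by_contra! hj
  obtain ⟨hlt, i₀, hi₀, hq⟩ := hj
  obtain ⟨i, hi, hqi⟩ := h (fun i => if i ∈ A j ∧ i ≠ i₀ then 0 else 1) (by
    intro l
    by_cases hl : l = j
    · subst hl
      exact ⟨i₀, hi₀, by simp⟩
    · obtain ⟨i, hi, hij⟩ := Set.not_subset.1 (hA l j hl)
      exact ⟨i, hi, by simp [hij]⟩) j
  have := hlt i hi
  by_cases hii : i = i₀
  · subst hii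
    simp at hqi
    omega
  · simp [hi, hii] at hqi
    omega

/-- A uniform order embedding, sending `0, 1, 2` to `0, q - 1, q`. -/
def stretch (q c : ℕ) : ℕ := if c = 0 then 0 else c + (q - 2)

theorem stretch_le_iff (q c t : ℕ) : stretch q c ≤ t ↔ c ≤ t - (q - 2) := by
  unfold stretch
  split_ifs <;> omega

theorem stretch_sub (q c : ℕ) : stretch q c - (q - 2) = c := by
  unfold stretch
  split_ifs <;> omega

theorem stretch_comp_le_iff (q : ℕ) (c t : Fin n → ℕ) :
    stretch q ∘ c ≤ t ↔ c ≤ fun i => t i - (q - 2) :=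
  forall_congr' fun i => stretch_le_iff q (c i) (t i)

theorem mem_colonExp_iff_two {q : ℕ} (hq : 2 ≤ q) (γ : Fin n → ℕ) :
    γ ∈ colonExp A q ↔ (fun i => γ i - (q - 2)) ∈ colonExp A 2 := by
  have h1 : ∀ i, 2 ≤ γ i - (q - 2) ↔ q ≤ γ i := fun i => by omega
  have h2 : ∀ i, 2 ≤ γ i - (q - 2) + 1 ↔ q ≤ γ i + 1 := fun i => by omega
  simp only [colonExp, Set.mem_ofPred_eq, h1, h2]

theorem mem_frobExp_iff_two {q : ℕ} (hq : 2 ≤ q) (γ : Fin n → ℕ) :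
    γ ∈ frobExp A q ↔ (fun i => γ i - (q - 2)) ∈ frobExp A 2 := by
  have h1 : ∀ i, 2 ≤ γ i - (q - 2) ↔ q ≤ γ i := fun i => by omega
  simp only [frobExp, Set.mem_ofPred_eq, h1]

theorem stretch_of_minimal {q : ℕ} (hq : 2 ≤ q) {γ : Fin n → ℕ}
    (hγ : Minimal (· ∈ colonExp A q) γ) : stretch q ∘ (fun i => γ i - (q - 2)) = γ := by
  have hle : stretch q ∘ (fun i => γ i - (q - 2)) ≤ γ := (stretch_comp_le_iff _ _ _).2 le_rfl
  refine le_antisymm hle (hγ.2 ((mem_colonExp_iff_two hq _).2 ?_) hle)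
  simpa only [Function.comp_apply, stretch_sub] using (mem_colonExp_iff_two hq γ).1 hγ.1

theorem eq_zero_of_minimal_colonExp {q : ℕ} (hq : 2 ≤ q) {γ : Fin n → ℕ}
    (hγ : Minimal (· ∈ colonExp A q) γ) {i : Fin n} (hi : γ i + 1 < q) : γ i = 0 := by
  rw [← congrFun (stretch_of_minimal hq hγ) i, Function.comp_apply, stretch, if_pos (by omega)]

theorem genExp_eq_image {q : ℕ} (hq : 2 ≤ q) :
    genExp A q = (fun c => stretch q ∘ c) '' genExp A 2 := by
  ext γ
  constructor
  · rintro ⟨hmin, hfrob, i, hi⟩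
    have hγ := stretch_of_minimal hq hmin
    refine ⟨_, ⟨⟨(mem_colonExp_iff_two hq γ).1 hmin.1, fun d hd hle => ?_⟩,
      fun h => hfrob ((mem_frobExp_iff_two hq γ).2 h), i, by omega⟩, hγ⟩
    have hd' : stretch q ∘ d ∈ colonExp A q := (mem_colonExp_iff_two hq _).2 (by
      simpa only [Function.comp_apply, stretch_sub] using hd)
    intro i
    have h := hmin.2 hd' ((stretch_comp_le_iff q d γ).2 hle) i
    exact (Nat.sub_le_sub_right h _).trans_eq (stretch_sub q (d i))
  · rintro ⟨c, ⟨hmin, hfrob, i, hi⟩, rfl⟩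
    have hc : (fun i => (stretch q ∘ c) i - (q - 2)) = c := funext fun i => stretch_sub q (c i)
    refine ⟨⟨(mem_colonExp_iff_two hq _).2 (by rw [hc]; exact hmin.1), fun d hd hle => ?_⟩,
      fun h => hfrob (hc ▸ (mem_frobExp_iff_two hq _).1 h), i, ?_⟩
    · refine (stretch_comp_le_iff q c d).2 (hmin.2 ((mem_colonExp_iff_two hq d).1 hd) fun i => ?_)
      exact (Nat.sub_le_sub_right (hle i) _).trans_eq (stretch_sub q (c i))
    · have := (stretch_le_iff q (c i) 0).2 (by omega)
      dsimp only [Function.comp_apply]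
      omega

theorem ncard_genExp {q : ℕ} (hq : 2 ≤ q) : (genExp A q).ncard = (genExp A 2).ncard := by
  rw [genExp_eq_image hq]
  refine Set.ncard_image_of_injective _ fun c d h => funext fun i => ?_
  rw [← stretch_sub q (c i), ← stretch_sub q (d i)]
  exact congrArg (· - (q - 2)) (congrFun h i)

theorem minimal_const_colonExp (hA : ∀ i, ∃ j, i ∈ A j) {q : ℕ} (hq : 1 ≤ q) :
    Minimal (· ∈ colonExp A q) fun _ => q - 1 := by
  refine ⟨fun j => Or.inr fun i _ => Nat.le_add_of_sub_le le_rfl, fun δ hδ hle i => ?_⟩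
  obtain ⟨j, hj⟩ := hA i
  rcases hδ j with ⟨i', _, h'⟩ | h
  · have := hle i'
    dsimp only at this
    omega
  · exact Nat.sub_le_of_le_add (h i hj)

theorem const_notMem_frobExp (hr : 0 < r) {q : ℕ} (hq : 1 ≤ q) :
    (fun _ => q - 1) ∉ frobExp A q := by
  intro h
  obtain ⟨i, _, hi⟩ := h ⟨0, hr⟩
  dsimp only at hi
  omega

theorem exists_genExp_le {q : ℕ} {γ : Fin n → ℕ} (hγ : γ ∈ colonExp A q) :
    γ ∈ frobExp A q ∨ (∀ i, q - 1 ≤ γ i) ∨ ∃ g ∈ genExp A q, g ≤ γ := by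
  obtain ⟨g, hgγ, hg⟩ := exists_minimal_le_of_wellFoundedLT (· ∈ colonExp A q) γ hγ
  by_cases h1 : g ∈ frobExp A q
  · exact Or.inl (isUpperSet_frobExp q hgγ h1)
  by_cases h2 : ∃ i, g i + 1 < q
  · exact Or.inr (Or.inr ⟨g, ⟨hg, h1, h2⟩, hgγ⟩)
  · push Not at h2
    exact Or.inr (Or.inl fun i => (Nat.sub_le_of_le_add (h2 i)).trans (hgγ i))

theorem exists_face_of_minimal {q : ℕ} {γ : Fin n → ℕ} (hγ : Minimal (· ∈ colonExp A q) γ)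
    {i : Fin n} (hi : γ i ≠ 0) :
    ∃ l, i ∈ A l ∧ (∀ i' ∈ A l, i' ≠ i → γ i' < q) ∧ γ i ≤ q ∧
      ∃ i₁ ∈ A l, γ i₁ + 1 < q ∨ (i₁ = i ∧ γ i < q) := by
  classical
  have hlt : Function.update γ i (γ i - 1) ≤ γ := by
    intro i'
    by_cases h : i' = i
    · subst h
      simp
    · simp [h]
  have hnot : Function.update γ i (γ i - 1) ∉ colonExp A q := fun h => by
    have := hγ.2 h hlt i
    simp at this
    omega
  simp only [colonExp, Set.mem_ofPred_eq, not_forall, not_or, not_exists, not_and, not_le] at hnot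
  obtain ⟨l, h1, i₁, hi₁, h2⟩ := hnot
  have hil : i ∈ A l := by
    by_contra hil
    have hne : ∀ i' ∈ A l, i' ≠ i := fun i' hi' e => hil (e ▸ hi')
    rcases hγ.1 l with ⟨i', hi', h⟩ | h
    · have := h1 i' hi'
      simp [hne i' hi'] at this
      omega
    · have := h i₁ hi₁
      simp [hne i₁ hi₁] at h2
      omega
  have h3 := h1 i hil
  simp at h3
  refine ⟨l, hil, fun i' hi' hne => by simpa [hne] using h1 i' hi', by omega, i₁, hi₁, ?_⟩
  by_cases hii : i₁ = i
  · subst hii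
    simp at h2
    omega
  · simp [hii] at h2
    omega

/-- A generator in `genExp` is not divisible by a monomial of `(I^{[a]} : I) (I^{[b]} : I)^{[a]}`. -/
theorem not_add_smul_le_of_mem_genExp (hA : ∀ i, ∃ j, i ∈ A j) {a b : ℕ} (ha : 2 ≤ a) (hb : 2 ≤ b)
    {γ δ ε : Fin n → ℕ} (hγ : γ ∈ genExp A (a * b)) (hδ : δ ∈ colonExp A a)
    (hε : ε ∈ colonExp A b) : ¬ δ + a • ε ≤ γ := by
  intro hle
  obtain ⟨hmin, -, i₀, hi₀⟩ := hγ
  have hle : ∀ i, δ i + a * ε i ≤ γ i := fun i => by simpa using hle i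
  have hq : 2 ≤ a * b := by nlinarith
  have big : ∀ i, b ≤ ε i → a * b ≤ a * ε i := fun i h => Nat.mul_le_mul_left a h
  have big' : ∀ i, b ≤ ε i + 1 → a * b ≤ a * ε i + a := fun i h => by
    simpa [mul_add] using Nat.mul_le_mul_left a h
  have pos : ∀ i, 1 ≤ ε i → a ≤ a * ε i := fun i h => by
    simpa using Nat.mul_le_mul_left a h
  have vanish : ∀ i, γ i + 1 < a * b → δ i = 0 ∧ ε i = 0 := by
    intro i hi
    have h0 := eq_zero_of_minimal_colonExp hq hmin hi
    have := hle i
    refine ⟨by omega, ?_⟩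
    by_contra h
    have := pos i (by omega)
    omega
  obtain ⟨i₂, hi₂⟩ : ∃ i, a * b ≤ γ i := by
    obtain ⟨j, hj⟩ := hA i₀
    rcases hmin.1 j with ⟨i, _, h⟩ | h
    · exact ⟨i, h⟩
    · have := h i₀ hj
      omega
  obtain ⟨l, hl, hlt, hle₂, i₁, hi₁, h₁⟩ := exists_face_of_minimal hmin (i := i₂) (by omega)
  have h₁ : γ i₁ + 1 < a * b := by omega
  obtain ⟨hδ₁, hε₁⟩ := vanish i₁ h₁
  obtain ⟨i₃, hi₃, hb₃⟩ : ∃ i ∈ A l, b ≤ ε i := by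
    rcases hε l with h | h
    · exact h
    · have := h i₁ hi₁
      omega
  obtain ⟨i₄, hi₄, ha₄⟩ : ∃ i ∈ A l, a ≤ δ i := by
    rcases hδ l with h | h
    · exact h
    · have := h i₁ hi₁
      omega
  have h₃₂ : i₃ = i₂ := by
    by_contra h
    have := hlt i₃ hi₃ h
    have := big i₃ hb₃
    have := hle i₃
    omega
  subst h₃₂
  have h₄₃ : i₄ ≠ i₃ := by
    rintro rfl
    have := big i₄ hb₃
    have := hle i₄
    omega
  have hlt₄ := hlt i₄ hi₄ h₄₃
  obtain ⟨l', hl', hlt', -⟩ := exists_face_of_minimal hmin (i := i₄) (by have := hle i₄; omega)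
  rcases hε l' with ⟨i, hi, h⟩ | h
  · have := big i h
    have := hle i
    by_cases hii : i = i₄
    · subst hii
      omega
    · have := hlt' i hi hii
      omega
  · have := big' i₄ (h i₄ hl')
    have := hle i₄
    omega

end Exponents

section Frobenius

variable {R : Type*} [CommRing R]

theorem frobPow_pow_eq_map (p m : ℕ) [ExpChar R p] (I : Ideal R) :
    frobPow (p ^ m) I = I.map (iterateFrobenius R p m) := rfl

theorem frobPow_one (I : Ideal R) : frobPow 1 I = I := by
  simp [frobPow]

theorem frobPow_span (p m : ℕ) [ExpChar R p] (s : Set R) :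
    frobPow (p ^ m) (Ideal.span s) = Ideal.span ((fun f => f ^ p ^ m) '' s) := by
  rw [frobPow_pow_eq_map, Ideal.map_span]
  rfl

theorem frobPow_frobPow (p a b : ℕ) [ExpChar R p] (I : Ideal R) :
    frobPow (p ^ a) (frobPow (p ^ b) I) = frobPow (p ^ (a + b)) I := by
  rw [frobPow_pow_eq_map, frobPow_pow_eq_map, frobPow_pow_eq_map, Ideal.map_map,
    iterateFrobenius_add]

theorem frobPow_mul (p m : ℕ) [ExpChar R p] (I J : Ideal R) :
    frobPow (p ^ m) (I * J) = frobPow (p ^ m) I * frobPow (p ^ m) J := by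
  simp only [frobPow_pow_eq_map, Ideal.map_mul]

theorem frobPow_prod (p m : ℕ) [ExpChar R p] {ι : Type*} (s : Finset ι) (I : ι → Ideal R) :
    frobPow (p ^ m) (∏ i ∈ s, I i) = ∏ i ∈ s, frobPow (p ^ m) (I i) := by
  simp only [frobPow_pow_eq_map]
  exact map_prod (Ideal.mapHom (iterateFrobenius R p m)) I s

theorem frobPow_mono {q : ℕ} {I J : Ideal R} (h : I ≤ J) : frobPow q I ≤ frobPow q J :=
  Ideal.span_mono (Set.image_mono h)

theorem le_colon_iff_mul_le {I J K : Ideal R} : K ≤ J.colon (I : Set R) ↔ K * I ≤ J := by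
  rw [Ideal.mul_le]
  exact forall₂_congr fun _ _ => Submodule.mem_colon

theorem colon_mul_frobPow_colon_le (p a b : ℕ) [ExpChar R p] (I : Ideal R) :
    (frobPow (p ^ a) I).colon I * frobPow (p ^ a) ((frobPow (p ^ b) I).colon I) ≤
      (frobPow (p ^ (a + b)) I).colon I := by
  have h : ∀ c, (frobPow (p ^ c) I).colon (I : Set R) * I ≤ frobPow (p ^ c) I := fun c =>
    le_colon_iff_mul_le.1 le_rfl
  rw [le_colon_iff_mul_le, mul_right_comm, ← frobPow_frobPow]
  refine (Ideal.mul_mono_left (h a)).trans ?_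
  rw [mul_comm, ← frobPow_mul]
  exact frobPow_mono (h b)

theorem prod_frobPow_succ (p : ℕ) [ExpChar R p] {s : ℕ} (β : Fin (s + 1) → ℕ) (K : ℕ → Ideal R) :
    ∏ i, frobPow (p ^ ∑ j ∈ Finset.Iio i, β j) (K (β i)) =
      K (β 0) * frobPow (p ^ β 0)
        (∏ i : Fin s, frobPow (p ^ ∑ j ∈ Finset.Iio i, β j.succ) (K (β i.succ))) := by
  have hsum : ∀ {m : ℕ} (i : Fin m) (γ : Fin m → ℕ),
      ∑ j ∈ Finset.Iio i, γ j = ∑ j, if j < i then γ j else 0 := by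
    intro m i γ
    rw [← Finset.sum_filter]
    exact Finset.sum_congr (by ext; simp) fun _ _ => rfl
  rw [Fin.prod_univ_succ, frobPow_prod]
  congr 1
  · simp [hsum, frobPow_one]
  · refine Finset.prod_congr rfl fun i _ => ?_
    rw [frobPow_frobPow]
    congr 2
    rw [hsum, hsum, Fin.sum_univ_succ]
    simp [Fin.succ_lt_succ_iff]

theorem prod_frobPow_colon_le (p : ℕ) [ExpChar R p] (I : Ideal R) {s : ℕ} (β : Fin s → ℕ) :
    ∏ i, frobPow (p ^ ∑ j ∈ Finset.Iio i, β j) ((frobPow (p ^ β i) I).colon (I : Set R)) ≤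
      (frobPow (p ^ ∑ i, β i) I).colon (I : Set R) := by
  induction s with
  | zero =>
    rw [le_colon_iff_mul_le]
    simp [frobPow_one]
  | succ s ih =>
    rw [prod_frobPow_succ p β fun b => (frobPow (p ^ b) I).colon (I : Set R), Fin.sum_univ_succ]
    exact (Ideal.mul_mono_right (frobPow_mono (ih fun i => β i.succ))).trans
      (colon_mul_frobPow_colon_le p _ _ I)

theorem Lideal_le (p e : ℕ) [ExpChar R p] {I J : Ideal R}
    (h : ∀ a b, 1 ≤ a → 1 ≤ b → a + b = e →
      (frobPow (p ^ a) I).colon (I : Set R) *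
        frobPow (p ^ a) ((frobPow (p ^ b) I).colon (I : Set R)) ≤ J) : Lideal p e I ≤ J := by
  refine iSup_le fun s => iSup_le fun hs => iSup_le fun β => iSup_le fun ⟨hβ, hsum⟩ => ?_
  obtain ⟨s, rfl⟩ := Nat.exists_eq_add_of_le' hs
  rw [prod_frobPow_succ (s := s + 1) p β fun b => (frobPow (p ^ b) I).colon (I : Set R)]
  refine (Ideal.mul_mono_right (frobPow_mono (prod_frobPow_colon_le p I fun i => β i.succ))).trans
    (h _ _ (hβ 0).1 ?_ ?_)
  · exact (hβ (Fin.succ 0)).1.trans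
      (Finset.single_le_sum (f := fun i : Fin (s + 1) => β i.succ) (by simp) (Finset.mem_univ 0))
  · rw [← hsum, Fin.sum_univ_succ β]

theorem colon_mul_frobPow_colon_le_Lideal (p : ℕ) [ExpChar R p] (I : Ideal R) {a b : ℕ}
    (ha : 1 ≤ a) (hb : 1 ≤ b) :
    (frobPow (p ^ a) I).colon (I : Set R) *
      frobPow (p ^ a) ((frobPow (p ^ b) I).colon (I : Set R)) ≤ Lideal p (a + b) I := by
  refine le_trans (le_of_eq ?_) (le_iSup_of_le 2 (le_iSup_of_le le_rfl (le_iSup_of_le ![a, b]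
    (le_iSup_of_le ⟨Fin.forall_fin_two.2 ⟨?_, ?_⟩, by simp⟩ le_rfl))))
  · rw [prod_frobPow_succ (s := 1) p ![a, b] fun b => (frobPow (p ^ b) I).colon (I : Set R)]
    simp [frobPow_one]
  · simp only [Matrix.cons_val_zero]
    omega
  · simp only [Matrix.cons_val_one, Matrix.cons_val_fin_one]
    omega

end Frobenius

section FaceIdeals

variable {k : Type*} [Field k] {n r : ℕ}

/-- The support of a `{0,1}`-vector. -/
def face (α : Fin r → Fin n → ℕ) (j : Fin r) : Set (Fin n) := {i | α j i = 1}

theorem faceIdeal_eq_span_mon (α : Fin n → ℕ) :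
    faceIdeal k α = Ideal.span (mon k '' {γ | ∃ i, α i = 1 ∧ γ = Pi.single i 1}) := by
  have hX : ∀ i, mon k (Pi.single i 1) = (MvPowerSeries.X i : MvPowerSeries (Fin n) k) := by
    intro i
    rw [mon, Finset.prod_eq_single i (by simp +contextual) (by simp)]
    simp
  rw [faceIdeal]
  congr 1
  ext f
  constructor
  · rintro ⟨i, hi, rfl⟩
    exact ⟨_, ⟨i, hi, rfl⟩, hX i⟩
  · rintro ⟨_, ⟨i, hi, rfl⟩, rfl⟩
    exact ⟨i, hi, hX i⟩

theorem iInf_faceIdeal_eq_span_mon (α : Fin r → Fin n → ℕ) :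
    ⨅ j, faceIdeal k (α j) = Ideal.span (mon k '' frobExp (face α) 1) := by
  ext f
  simp only [Ideal.mem_iInf, faceIdeal_eq_span_mon, mem_span_mon_iff]
  have hsingle : ∀ (i : Fin n) (d : Fin n →₀ ℕ), Pi.single i 1 ≤ ⇑d ↔ 1 ≤ d i := by
    intro i d
    refine ⟨fun h => by simpa using h i, fun h i' => ?_⟩
    by_cases hii : i' = i
    · subst hii
      simpa using h
    · simp [hii]
  constructor
  · refine fun h d hd => ⟨d, fun j => ?_, le_rfl⟩
    obtain ⟨_, ⟨i, hi, rfl⟩, hle⟩ := h j d hd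
    exact ⟨i, hi, (hsingle i d).1 hle⟩
  · intro h j d hd
    obtain ⟨u, hu, hud⟩ := h d hd
    obtain ⟨i, hi, hi1⟩ := hu j
    exact ⟨_, ⟨i, hi, rfl⟩, (hsingle i d).2 (hi1.trans (hud i))⟩

variable {A : Fin r → Set (Fin n)}

theorem frobPow_span_mon_frobExp (p m : ℕ) [ExpChar (MvPowerSeries (Fin n) k) p] :
    frobPow (p ^ m) (Ideal.span (mon k '' frobExp A 1)) =
      Ideal.span (mon k '' frobExp A (p ^ m)) := by
  classical
  have himage : (fun f : MvPowerSeries (Fin n) k => f ^ p ^ m) '' (mon k '' frobExp A 1) =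
      mon k '' ((fun γ => p ^ m • γ) '' frobExp A 1) := by
    simp only [Set.image_image, mon_nsmul]
  rw [frobPow_span, himage]
  refine le_antisymm (span_mon_le_span_mon ?_) (span_mon_le_span_mon ?_)
  · rintro _ ⟨γ, hγ, rfl⟩
    refine ⟨_, fun j => ?_, le_rfl⟩
    obtain ⟨i, hi, h⟩ := hγ j
    exact ⟨i, hi, by simpa using Nat.mul_le_mul_left (p ^ m) h⟩
  · intro γ hγ
    refine ⟨_, ⟨fun i => if p ^ m ≤ γ i then 1 else 0, fun j => ?_, rfl⟩, fun i => ?_⟩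
    · obtain ⟨i, hi, h⟩ := hγ j
      exact ⟨i, hi, by simp [h]⟩
    · by_cases h : p ^ m ≤ γ i <;> simp [h]

theorem colon_span_mon_frobExp (hA : ∀ j l, j ≠ l → ¬ A j ⊆ A l) (q : ℕ) :
    (Ideal.span (mon k '' frobExp A q)).colon (Ideal.span (mon k '' frobExp A 1) : Set _) =
      Ideal.span (mon k '' colonExp A q) := by
  refine le_antisymm (fun f hf => ?_) ?_
  · rw [mem_span_mon_iff]
    refine fun d hd => ⟨d, mem_colonExp_of_forall_add_mem hA fun u hu => ?_, le_rfl⟩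
    have h := Submodule.mem_colon.1 hf (mon k u) (Ideal.subset_span ⟨u, hu, rfl⟩)
    obtain ⟨v, hv, hvd⟩ := (mem_span_mon_iff _ _).1 h (d + Finsupp.equivFunOnFinite.symm u) (by
      rwa [smul_eq_mul, mon_eq_monomial, MvPowerSeries.coeff_add_mul_monomial, mul_one])
    exact isUpperSet_frobExp q hvd hv
  · rw [le_colon_iff_mul_le]
    exact span_mon_mul_span_mon_le fun γ hγ u hu => ⟨_, add_mem_frobExp hγ hu, le_rfl⟩

theorem frobPow_span_mon_colonExp_le (p m q : ℕ) [ExpChar (MvPowerSeries (Fin n) k) p] :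
    frobPow (p ^ m) (Ideal.span (mon k '' colonExp A q)) ≤
      Ideal.span (mon k '' ((fun ε => p ^ m • ε) '' colonExp A q)) := by
  rw [frobPow_span, Set.image_image, Set.image_image]
  simp only [mon_nsmul, le_refl]

theorem span_mon_colonExp_le (q : ℕ) :
    Ideal.span (mon k '' colonExp A q) ≤ Ideal.span (mon k '' frobExp A q) ⊔
      Ideal.span {mon k fun _ => q - 1} ⊔ Ideal.span (mon k '' genExp A q) := by
  rw [← Set.image_singleton, ← Ideal.span_union, ← Set.image_union, ← Ideal.span_union,
    ← Set.image_union]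
  refine span_mon_le_span_mon fun γ hγ => ?_
  rcases exists_genExp_le hγ with h | h | ⟨g, hg, hgγ⟩
  · exact ⟨γ, Or.inl (Or.inl h), le_rfl⟩
  · exact ⟨_, Or.inl (Or.inr rfl), h⟩
  · exact ⟨g, Or.inr hg, hgγ⟩

theorem Jideal_eq_span_mon_genExp (hA : ∀ j l, j ≠ l → ¬ A j ⊆ A l) {p m : ℕ}
    [ExpChar (MvPowerSeries (Fin n) k) p] :
    Jideal k (p ^ m) (Ideal.span (mon k '' frobExp A 1)) =
      Ideal.span (mon k '' genExp A (p ^ m)) := by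
  have hpow : mon k (fun _ : Fin n => 1) ^ (p ^ m - 1) = mon k fun _ => p ^ m - 1 := by
    rw [← mon_nsmul]
    congr 1
    ext
    simp
  have hmem : ∀ γ : Fin n → ℕ, mon k γ ∉ Ideal.span {mon k fun _ => p ^ m - 1} ↔
      ∃ i, γ i + 1 < p ^ m := by
    intro γ
    rw [← Set.image_singleton, mon_mem_span_mon_iff]
    simp only [Set.mem_singleton_iff, exists_eq_left, Pi.le_def, not_forall, not_le,
      Nat.lt_sub_iff_add_lt]
  simp only [Jideal, genExp, hpow, hmem, frobPow_span_mon_frobExp, colon_span_mon_frobExp hA,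
    isMinGen_span_mon_iff (isUpperSet_colonExp _),
    mon_mem_span_mon_iff_of_isUpperSet (isUpperSet_frobExp _)]

theorem muIdeal_span_mon_genExp (q : ℕ) :
    muIdeal (Ideal.span (mon k '' genExp A q)) = (genExp A q).ncard := by
  rw [muIdeal_eq_muQuot_bot]
  exact muQuot_eq_ncard (U := colonExp A q) (V := ∅) (by simp)
    (span_mon_le_span_mon fun γ hγ => ⟨γ, hγ.1.1, le_rfl⟩) bot_le (fun _ h => h.1) (by simp)

theorem muQuot_colon_frobPow (hr : 0 < r) (hA' : ∀ i, ∃ j, i ∈ A j) {q : ℕ} (hq : 2 ≤ q) :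
    muQuot (Ideal.span (mon k '' colonExp A q)) (Ideal.span (mon k '' frobExp A q)) =
      (genExp A q).ncard + 1 := by
  have hnot : (fun _ => q - 1) ∉ genExp A q := by
    rintro ⟨-, -, i, hi⟩
    dsimp only at hi
    omega
  have hfin : (genExp A q).Finite := (finite_setOf_minimal _).subset fun _ h => h.1
  have hmin := minimal_const_colonExp hA' (q := q) (by omega)
  rw [← Set.ncard_insert_of_notMem hnot hfin]
  refine muQuot_eq_ncard (U := colonExp A q) (V := frobExp A q) ?_ le_rfl le_rfl ?_ ?_
  · refine le_antisymm ((span_mon_colonExp_le q).trans_eq ?_)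
      (sup_le (Ideal.span_mono (Set.image_mono (frobExp_subset_colonExp q)))
        (Ideal.span_mono (Set.image_mono ?_)))
    · rw [sup_assoc, ← Ideal.span_union, ← Set.image_singleton, ← Set.image_union,
        Set.singleton_union]
    · exact Set.insert_subset hmin.1 fun _ h => h.1.1
  · rintro _ (rfl | h)
    · exact hmin
    · exact h.1
  · rintro _ (rfl | h) v hv hle
    · exact const_notMem_frobExp hr (by omega) (isUpperSet_frobExp q hle hv)
    · exact h.2.1 (isUpperSet_frobExp q hle hv)

theorem muQuot_colon_Lideal (hA : ∀ j l, j ≠ l → ¬ A j ⊆ A l) (hA' : ∀ i, ∃ j, i ∈ A j)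
    (p : ℕ) (hp : 2 ≤ p) [ExpChar (MvPowerSeries (Fin n) k) p] {e : ℕ} (he : 2 ≤ e) :
    muQuot (Ideal.span (mon k '' colonExp A (p ^ e)))
      (Lideal p e (Ideal.span (mon k '' frobExp A 1)) ⊔
        Ideal.span (mon k '' frobExp A (p ^ e))) = (genExp A (p ^ e)).ncard := by
  set I := Ideal.span (mon k '' frobExp A 1) with hI
  have hcolon : ∀ m, (frobPow (p ^ m) I).colon (I : Set (MvPowerSeries (Fin n) k)) =
      Ideal.span (mon k '' colonExp A (p ^ m)) := fun m => by
    rw [hI, frobPow_span_mon_frobExp, colon_span_mon_frobExp hA]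
  have htwo : ∀ m, 1 ≤ m → 2 ≤ p ^ m := fun m hm => hp.trans (Nat.le_self_pow (by omega) p)
  have hLcolon : Lideal p e I ≤ Ideal.span (mon k '' colonExp A (p ^ e)) :=
    Lideal_le p e fun a b _ _ hab => by
      rw [← hcolon, ← hab]
      exact colon_mul_frobPow_colon_le p a b I
  have hconst : mon k (fun _ => p ^ e - 1) ∈ Lideal p e I := by
    obtain ⟨b, rfl⟩ := Nat.exists_eq_add_of_le (by omega : 1 ≤ e)
    refine colon_mul_frobPow_colon_le_Lideal p I le_rfl (by omega) ?_
    have hsplit : (fun _ : Fin n => p ^ (1 + b) - 1) =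
        (fun _ => p ^ 1 - 1) + p ^ 1 • fun _ => p ^ b - 1 := by
      ext
      have := htwo b (by omega)
      simp only [Pi.add_apply, Pi.smul_apply, smul_eq_mul, pow_add, Nat.mul_sub, pow_one, mul_one]
      have : p * 1 ≤ p * p ^ b := Nat.mul_le_mul_left p (by omega)
      omega
    rw [hsplit, mon_add, mon_nsmul, hcolon, hcolon]
    have hmem : ∀ m, mon k (fun _ => p ^ m - 1) ∈ Ideal.span (mon k '' colonExp A (p ^ m)) :=
      fun m => Ideal.subset_span
        ⟨_, (minimal_const_colonExp hA' (Nat.one_le_pow _ _ (by omega))).1, rfl⟩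
    exact Ideal.mul_mem_mul (hmem 1) (Ideal.subset_span ⟨_, hmem b, rfl⟩)
  let W : Set (Fin n → ℕ) := {γ | ∃ a b, 1 ≤ a ∧ 1 ≤ b ∧ a + b = e ∧
    ∃ δ ∈ colonExp A (p ^ a), ∃ ε ∈ colonExp A (p ^ b), γ = δ + p ^ a • ε}
  have hLW : Lideal p e I ≤ Ideal.span (mon k '' W) := Lideal_le p e fun a b ha hb hab => by
    rw [hcolon, hcolon]
    refine (Ideal.mul_mono_right (frobPow_span_mon_colonExp_le p a (p ^ b))).trans
      (span_mon_mul_span_mon_le ?_)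
    rintro δ hδ _ ⟨ε, hε, rfl⟩
    exact ⟨_, ⟨a, b, ha, hb, hab, δ, hδ, ε, hε, rfl⟩, le_rfl⟩
  refine muQuot_eq_ncard (U := colonExp A (p ^ e)) (V := W ∪ frobExp A (p ^ e)) ?_ ?_ ?_ ?_ ?_
  · refine le_antisymm ((span_mon_colonExp_le _).trans (sup_le_sup_right (sup_le le_sup_right ?_) _))
      (sup_le (sup_le hLcolon ?_) ?_)
    · rw [Ideal.span_singleton_le_iff_mem]
      exact Ideal.mem_sup_left hconst
    · exact Ideal.span_mono (Set.image_mono (frobExp_subset_colonExp _))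
    · exact Ideal.span_mono (Set.image_mono fun _ h => h.1.1)
  · exact le_rfl
  · rw [Set.image_union, Ideal.span_union]
    exact sup_le_sup_right hLW _
  · exact fun _ h => h.1
  · rintro g hg _ (⟨a, b, ha, hb, rfl, δ, hδ, ε, hε, rfl⟩ | hv) hle
    · rw [pow_add] at hg
      exact not_add_smul_le_of_mem_genExp hA' (htwo a ha) (htwo b hb) hg hδ hε hle
    · exact hg.2.1 (isUpperSet_frobExp _ hle hv)

theorem Lideal_one {R : Type*} [CommRing R] (p : ℕ) (I : Ideal R) : Lideal p 1 I = ⊥ := by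
  refine le_bot_iff.1 (iSup_le fun s => iSup_le fun hs => iSup_le fun β => iSup_le fun ⟨hβ, _⟩ => ?_)
  have := hβ ⟨0, by omega⟩
  omega

theorem exists_mem_face_of_iSup_faceIdeal {α : Fin r → Fin n → ℕ}
    (hsum : (⨆ j, faceIdeal k (α j)) =
      Ideal.span (Set.range (MvPowerSeries.X : Fin n → MvPowerSeries (Fin n) k)))
    (i : Fin n) : ∃ j, i ∈ face α j := by
  have hX : mon k (Pi.single i 1) ∈ ⨆ j, faceIdeal k (α j) := by
    rw [hsum, mon, Finset.prod_eq_single i (by simp +contextual) (by simp)]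
    exact Ideal.subset_span ⟨i, by simp⟩
  simp only [faceIdeal_eq_span_mon] at hX
  rw [← Submodule.span_iUnion, ← Set.image_iUnion] at hX
  obtain ⟨_, hu, hle⟩ := (mon_mem_span_mon_iff _ _).1 hX
  obtain ⟨j, i', hi', rfl⟩ := Set.mem_iUnion.1 hu
  have h := hle i'
  by_cases hii : i' = i
  · exact ⟨j, hii ▸ hi'⟩
  · simp [hii] at h

end FaceIdeals

theorem statement11 (p : ℕ) [Fact p.Prime] (k : Type*) [Field k] [CharP k p]
    (n : ℕ) (hn : 0 < n) (r : ℕ) (hr : 0 < r) (α : Fin r → Fin n → ℕ)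
    (I : Ideal (MvPowerSeries (Fin n) k)) (hdec : IsMinFaceDecomp k α I)
    (hsum : (⨆ j, faceIdeal k (α j)) =
      Ideal.span (Set.range (MvPowerSeries.X : Fin n → MvPowerSeries (Fin n) k))) :
    cseq p k I 0 = 0 ∧ cseq p k I 1 = muIdeal (Jideal k p I) + 1 ∧
      ∀ e, 2 ≤ e → cseq p k I e = muIdeal (Jideal k p I) := by
  have : CharP (MvPowerSeries (Fin n) k) p :=
    charP_of_injective_algebraMap (algebraMap k (MvPowerSeries (Fin n) k)).injective p
  have : ExpChar (MvPowerSeries (Fin n) k) p := .prime Fact.out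
  have hp : 2 ≤ p := (Fact.out : p.Prime).two_le
  obtain ⟨-, -, hI, hA⟩ := hdec
  change ∀ j l, j ≠ l → ¬ face α j ⊆ face α l at hA
  have hA' := exists_mem_face_of_iSup_faceIdeal hsum
  rw [iInf_faceIdeal_eq_span_mon] at hI
  have hJ : muIdeal (Jideal k p I) = (genExp (face α) 2).ncard := by
    rw [hI, ← ncard_genExp hp, ← muIdeal_span_mon_genExp (k := k)]
    have h := Jideal_eq_span_mon_genExp (k := k) hA (p := p) (m := 1)
    rw [pow_one] at h
    rw [h]
  refine ⟨rfl, ?_, fun e he => ?_⟩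
  · rw [hJ, cseq, zero_add, pow_one, Lideal_one, bot_sup_eq, hI]
    have hf := frobPow_span_mon_frobExp (k := k) (A := face α) p 1
    rw [pow_one] at hf
    rw [hf, colon_span_mon_frobExp hA, muQuot_colon_frobPow hr hA' hp, ncard_genExp hp]
  · obtain ⟨e, rfl⟩ := Nat.exists_eq_add_of_le' (by omega : 1 ≤ e)
    rw [hJ, cseq, hI, frobPow_span_mon_frobExp, colon_span_mon_frobExp hA,
      muQuot_colon_Lideal hA hA' p hp he,
      ncard_genExp (hp.trans (Nat.le_self_pow (by omega) p))]

end
end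

section
/- Let I ⊆ S be a squarefree monomial ideal. Then for every e ≥ 2 and q = p^e, the element (x_1⋯x_n)^{q-1} belongs to the product K_1·(K_{e-1})^{[p]}, where K_a = (I^{[p^a]} :_S I); in particular (x_1⋯x_n)^{q-1} ∈ L_e for every e ≥ 2. -/
noncomputable section

/-- A squarefree monomial ideal: an ideal generated by squarefree monomials. -/
def IsSqfreeMonomialIdeal (k : Type*) [Field k] {n : ℕ}
    (I : Ideal (MvPowerSeries (Fin n) k)) : Prop :=
  ∃ G : Set (Fin n → ℕ), (∀ γ ∈ G, ∀ i, γ i ≤ 1) ∧ I = Ideal.span (mon k '' G)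

theorem mon_one_eq_mul (k : Type*) [Field k] {n : ℕ} {γ : Fin n → ℕ} (h : ∀ i, γ i ≤ 1) :
    mon k (fun _ => 1) = mon k γ * mon k (fun i => 1 - γ i) := by
  simp only [mon, ← Finset.prod_mul_distrib, ← pow_add]
  exact Finset.prod_congr rfl fun i _ => by rw [Nat.add_sub_cancel' (h i)]

theorem pow_mem_frobPow {R : Type*} [CommRing R] (q : ℕ) {I : Ideal R} {f : R} (hf : f ∈ I) :
    f ^ q ∈ frobPow q I :=
  Ideal.subset_span ⟨f, hf, rfl⟩

theorem le_frobPow_one {R : Type*} [CommRing R] (I : Ideal R) : I ≤ frobPow 1 I :=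
  fun f hf => by simpa using pow_mem_frobPow 1 hf

/-- For a squarefree monomial ideal `I` and `q ≥ 1`, `(x_1⋯x_n)^{q-1} ∈ (I^{[q]} : I)`. -/
theorem mon_one_pow_mem_colon {k : Type*} [Field k] {n : ℕ}
    {I : Ideal (MvPowerSeries (Fin n) k)} (hI : IsSqfreeMonomialIdeal k I) {q : ℕ} (hq : 1 ≤ q) :
    mon k (fun _ => 1) ^ (q - 1) ∈ (frobPow q I).colon I := by
  obtain ⟨G, hG, rfl⟩ := hI
  rw [Submodule.mem_colon]
  intro f hf
  induction hf using Submodule.span_induction with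
  | mem f hf =>
    obtain ⟨γ, hγ, rfl⟩ := hf
    have key : mon k (fun _ : Fin n => 1) ^ (q - 1) • mon k γ
        = mon k (fun i => 1 - γ i) ^ (q - 1) * mon k γ ^ q := by
      obtain ⟨r, rfl⟩ := Nat.exists_eq_add_of_le hq
      rw [mon_one_eq_mul k (hG γ hγ), Nat.add_sub_cancel_left, smul_eq_mul]
      ring
    rw [key]
    exact Ideal.mul_mem_left _ _ (pow_mem_frobPow q (Ideal.subset_span ⟨γ, hγ, rfl⟩))
  | zero => simp
  | add a b _ _ ha hb => rw [smul_add]; exact add_mem ha hb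
  | smul c a _ ha => rw [smul_comm]; exact Submodule.smul_mem _ c ha

theorem colon_mul_frobPow_colon_le_Lideal_s17 {R : Type*} [CommRing R] (p : ℕ) {e : ℕ} (he : 2 ≤ e)
    (I : Ideal R) :
    (frobPow p I).colon I * frobPow p ((frobPow (p ^ (e - 1)) I).colon I) ≤ Lideal p e I := by
  have hβ : (∀ i, 1 ≤ ![1, e - 1] i ∧ ![1, e - 1] i < e) ∧ ∑ i, ![1, e - 1] i = e := by
    refine ⟨fun i => ?_, ?_⟩
    · fin_cases i <;> simp <;> omega
    · simp; omega
  refine le_trans ?_ (le_iSup₂_of_le 2 le_rfl (le_iSup₂_of_le ![1, e - 1] hβ le_rfl))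
  have h0 : (Finset.Iio (0 : Fin 2)) = ∅ := by decide
  have h1 : (Finset.Iio (1 : Fin 2)) = {0} := by decide
  rw [Fin.prod_univ_two, h0, h1]
  simpa using Ideal.mul_mono_left (le_frobPow_one _)

theorem statement17 (p : ℕ) [Fact p.Prime] (k : Type*) [Field k] [CharP k p]
    (n : ℕ) (hn : 0 < n) (I : Ideal (MvPowerSeries (Fin n) k))
    (hI : IsSqfreeMonomialIdeal k I) (e : ℕ) (he : 2 ≤ e) :
    mon k (fun _ => 1) ^ (p ^ e - 1) ∈
        ((frobPow p I).colon I) * frobPow p ((frobPow (p ^ (e - 1)) I).colon I) ∧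
      mon k (fun _ => 1) ^ (p ^ e - 1) ∈ Lideal p e I := by
  have hp : 1 ≤ p := (Fact.out : p.Prime).one_le
  have hmem : mon k (fun _ => 1) ^ (p ^ e - 1) ∈
      ((frobPow p I).colon I) * frobPow p ((frobPow (p ^ (e - 1)) I).colon I) := by
    have hq : 1 ≤ p ^ (e - 1) := Nat.one_le_pow _ _ hp
    have hexp : p ^ e - 1 = (p - 1) + (p ^ (e - 1) - 1) * p := by
      have hpe : p ^ e = p ^ (e - 1) * p := by rw [← pow_succ, Nat.sub_add_cancel (by omega)]
      have := Nat.le_mul_of_pos_left p hq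
      rw [hpe, Nat.sub_mul]
      omega
    rw [hexp, pow_add, pow_mul]
    exact Ideal.mul_mem_mul (mon_one_pow_mem_colon hI hp)
      (pow_mem_frobPow p (mon_one_pow_mem_colon hI hq))
  exact ⟨hmem, colon_mul_frobPow_colon_le_Lideal_s17 p he I hmem⟩

end
end
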